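/- Let n ≥ 3 and let v be a harmonic function on ℝⁿ \ B̄₁ satisfying |v(x)| ≤ C|x|^(2−k₃)(log|x|)^(k₄) for some k₃ ≥ n, k₄ ≥ 0, and constants C. Then in the spherical harmonic expansion v(rθ) = Σ_k Σ_m a_{k,m}(r) Y_m^{(k)}(θ), each coefficient satisfies a_{k,m}(r) = C₂_{k,m}·r^(2−n−k), i.e., the coefficients C₁_{k,m} of r^k all vanish, and furthermore C₂_{k,m} = 0 for all k < k₃ − n. -/

import Mathlib

open MeasureTheory Real Metric
open Set Filter Topology

/-- A continuous function supported in a compact interval and of integral zero has an antiderivative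
supported in the same interval. -/
lemma exists_antideriv_of_integral_eq_zero {f : ℝ → ℝ} (hf : Continuous f) {α β : ℝ}
    (hs : ∀ x ∉ Icc α β, f x = 0) (h : ∫ x, f x = 0) :
    ∃ F : ℝ → ℝ, (∀ x, HasDerivAt F (f x) x) ∧ ∀ x ∉ Icc α β, F x = 0 := by
  refine ⟨fun x => ∫ t in (α - 1)..x, f t, fun x => ?_, fun x hx => ?_⟩
  · exact intervalIntegral.integral_hasDerivAt_right (hf.intervalIntegrable _ _)
      (hf.stronglyMeasurableAtFilter _ _) hf.continuousAt
  · by_cases hxα : x < α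
    · refine (intervalIntegral.integral_congr (g := fun _ => 0) fun t ht => hs t ?_).trans (by simp)
      intro ht'
      have := ht.2
      have : t < α := lt_of_le_of_lt this (max_lt (by linarith) hxα)
      exact absurd ht'.1 (not_le.2 this)
    · have hxβ : β < x := by
        by_contra hc
        exact hx ⟨not_lt.1 hxα, not_lt.1 hc⟩
      change ∫ t in (α - 1)..x, f t = 0
      rw [intervalIntegral.integral_eq_integral_of_support_subset, h]
      intro t ht
      have : t ∈ Icc α β := by
        by_contra hc
        exact ht (hs t hc)
      exact ⟨by linarith [this.1], by linarith [this.2]⟩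

/-- A compact subset of an open half-line lies in a compact interval of that half-line. -/
lemma IsCompact.exists_subset_Icc_of_subset_Ioi {K : Set ℝ} (hK : IsCompact K) {c : ℝ}
    (h : K ⊆ Ioi c) : ∃ α β, c < α ∧ K ⊆ Icc α β := by
  rcases K.eq_empty_or_nonempty with rfl | hne
  · exact ⟨c + 1, c, by linarith, by simp⟩
  · exact ⟨sInf K, sSup K, h (hK.sInf_mem hne), fun x hx =>
      ⟨csInf_le hK.bddBelow hx, le_csSup hK.bddAbove hx⟩⟩

/-- The product of a function continuous on an open set with a continuous function supported
inside this set is continuous. -/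
lemma ContinuousOn.continuous_mul_of_tsupport_subset {X : Type*} [TopologicalSpace X]
    {f g : X → ℝ} {U : Set X} (hU : IsOpen U) (hf : ContinuousOn f U) (hg : Continuous g)
    (hgU : tsupport g ⊆ U) : Continuous fun x => f x * g x := by
  refine continuous_iff_continuousAt.2 fun x => ?_
  by_cases hx : x ∈ U
  · exact (hf.continuousAt (hU.mem_nhds hx)).mul hg.continuousAt
  · have h0 : (fun x => f x * g x) =ᶠ[𝓝 x] fun _ => 0 := by
      filter_upwards [notMem_tsupport_iff_eventuallyEq.1 (fun h => hx (hgU h))] with y hy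
      simp [hy]
    exact continuousAt_const.congr h0.symm

lemma integral_sub_mul_add_mul {X : Type*} [MeasurableSpace X] {μ : Measure X} {f g h : X → ℝ}
    (hf : Integrable f μ) (hg : Integrable g μ) (hh : Integrable h μ) (p q : ℝ) :
    ∫ x, f x - (p * g x + q * h x) ∂μ
      = ∫ x, f x ∂μ - (p * ∫ x, g x ∂μ + q * ∫ x, h x ∂μ) := by
  have h₁ : Integrable (fun x => p * g x + q * h x) μ := (hg.const_mul p).add (hh.const_mul q)
  rw [integral_sub hf h₁, integral_add (hg.const_mul p) (hh.const_mul q), integral_const_mul,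
    integral_const_mul]

/-- A du Bois-Reymond lemma: a continuous function which annihilates all the test functions
annihilated by `1` and by a strictly monotone function `σ` is a combination of `1` and `σ`. -/
lemma exists_eq_add_mul_of_integral_eq_zero {b σ : ℝ → ℝ} {c : ℝ} (hb : ContinuousOn b (Ioi c))
    (hσ : ContinuousOn σ (Ioi c)) (hanti : StrictAntiOn σ (Ioi c))
    (h : ∀ g : ℝ → ℝ, Continuous g → HasCompactSupport g → tsupport g ⊆ Ioi c →
      ∫ x, g x = 0 → ∫ x, σ x * g x = 0 → ∫ x, b x * g x = 0) :
    ∃ c₁ c₂ : ℝ, ∀ x, c < x → b x = c₁ + c₂ * σ x := by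
  have hint : ∀ f : ℝ → ℝ, ContinuousOn f (Ioi c) → ∀ g : ℝ → ℝ, Continuous g →
      HasCompactSupport g → tsupport g ⊆ Ioi c → Integrable fun x => f x * g x := by
    intro f hf g hg hgc hgs
    exact (hf.continuous_mul_of_tsupport_subset isOpen_Ioi hg hgs).integrable_of_hasCompactSupport
      hgc.mul_left
  -- two bump functions with disjoint supports
  let f₁ : ContDiffBump (c + 2) := ⟨1 / 2, 1, by norm_num, by norm_num⟩
  let f₂ : ContDiffBump (c + 4) := ⟨1 / 2, 1, by norm_num, by norm_num⟩
  have hs₁ : tsupport f₁ = Icc (c + 1) (c + 3) := by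
    rw [f₁.tsupport_eq, Real.closedBall_eq_Icc]; congr 1 <;> simp [f₁] <;> ring
  have hs₂ : tsupport f₂ = Icc (c + 3) (c + 5) := by
    rw [f₂.tsupport_eq, Real.closedBall_eq_Icc]; congr 1 <;> simp [f₂] <;> ring
  have hs₁' : tsupport f₁ ⊆ Ioi c := by
    rw [hs₁]; intro x hx; exact mem_Ioi.2 (by linarith [hx.1])
  have hs₂' : tsupport f₂ ⊆ Ioi c := by
    rw [hs₂]; intro x hx; exact mem_Ioi.2 (by linarith [hx.1])
  have hp₁ : 0 < ∫ x, f₁ x := f₁.integral_pos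
  have hp₂ : 0 < ∫ x, f₂ x := f₂.integral_pos
  have hi₁ := hint σ hσ f₁ f₁.continuous f₁.hasCompactSupport hs₁'
  have hi₂ := hint σ hσ f₂ f₂.continuous f₂.hasCompactSupport hs₂'
  have hm : σ (c + 3) * ∫ x, f₁ x < ∫ x, σ x * f₁ x := by
    have hc₁ : Continuous fun x => (σ x - σ (c + 3)) * f₁ x :=
      (hσ.sub continuousOn_const).continuous_mul_of_tsupport_subset isOpen_Ioi f₁.continuous hs₁'
    have hpos : 0 < ∫ x, (σ x - σ (c + 3)) * f₁ x := by
      refine hc₁.integral_pos_of_hasCompactSupport_nonneg_nonzero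
        f₁.hasCompactSupport.mul_left (fun x => ?_) (x := c + 2) ?_
      · by_cases hx : x ∈ tsupport f₁
        · have hx' := hs₁ ▸ hx
          refine mul_nonneg (sub_nonneg.2 ?_) f₁.nonneg
          exact hanti.antitoneOn (hs₁' hx) (by simp) hx'.2
        · simp [image_eq_zero_of_notMem_tsupport hx]
      · have : σ (c + 3) < σ (c + 2) := hanti (by simp) (by simp) (by linarith)
        have h1 : f₁ (c + 2) = 1 := f₁.one_of_mem_closedBall (mem_closedBall_self f₁.rIn_pos.le)
        rw [h1, mul_one]
        exact (sub_pos.2 this).ne'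
    simp only [sub_mul] at hpos
    rw [integral_sub hi₁ (f₁.integrable.const_mul _), integral_const_mul] at hpos
    linarith
  have hm' : ∫ x, σ x * f₂ x ≤ σ (c + 3) * ∫ x, f₂ x := by
    rw [← integral_const_mul]
    refine integral_mono hi₂ (f₂.integrable.const_mul _) fun x => ?_
    by_cases hx : x ∈ tsupport f₂
    · have hx' := hs₂ ▸ hx
      exact mul_le_mul_of_nonneg_right (hanti.antitoneOn (by simp) (hs₂' hx) hx'.1) f₂.nonneg
    · simp [image_eq_zero_of_notMem_tsupport hx]
  set A₁ := ∫ x, f₁ x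
  set A₂ := ∫ x, f₂ x
  set S₁ := ∫ x, σ x * f₁ x
  set S₂ := ∫ x, σ x * f₂ x
  have hD : A₁ * S₂ - A₂ * S₁ < 0 := by nlinarith
  set D := A₁ * S₂ - A₂ * S₁
  set B₁ := ∫ x, b x * f₁ x
  set B₂ := ∫ x, b x * f₂ x
  refine ⟨(B₁ * S₂ - B₂ * S₁) / D, (B₂ * A₁ - B₁ * A₂) / D, ?_⟩
  set c₁ := (B₁ * S₂ - B₂ * S₁) / D
  set c₂ := (B₂ * A₁ - B₁ * A₂) / D
  have hcont : ContinuousOn (fun x => b x - (c₁ + c₂ * σ x)) (Ioi c) := by fun_prop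
  have hae := isOpen_Ioi.ae_eq_zero_of_integral_contDiff_smul_eq_zero
    (hcont.locallyIntegrableOn measurableSet_Ioi (μ := volume)) (fun g hg hgc hgs => ?_)
  · intro x hx
    have : EqOn (fun x => b x - (c₁ + c₂ * σ x)) (fun _ => 0) (Ioi c) := by
      refine Measure.eqOn_open_of_ae_eq (μ := volume) ?_ isOpen_Ioi hcont continuousOn_const
      exact (ae_restrict_iff' measurableSet_Ioi).2 hae
    linarith [this hx]
  · have hgi := hg.continuous.integrable_of_hasCompactSupport (μ := volume) hgc
    have hgσ := hint σ hσ g hg.continuous hgc hgs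
    have hgb := hint b hb g hg.continuous hgc hgs
    set A := ∫ x, g x
    set S := ∫ x, σ x * g x
    -- correct `g` by the dual functions
    set p := (A * S₂ - S * A₂) / D with hp
    set q := (S * A₁ - A * S₁) / D with hq
    have hcorr := h (fun x => g x - (p * f₁ x + q * f₂ x))
      (hg.continuous.sub ((f₁.continuous.const_mul p).add (f₂.continuous.const_mul q)))
      (hgc.sub (f₁.hasCompactSupport.mul_left.add f₂.hasCompactSupport.mul_left)) ?_ ?_ ?_
    · have e : ∀ x, b x * (g x - (p * f₁ x + q * f₂ x))
          = b x * g x - (p * (b x * f₁ x) + q * (b x * f₂ x)) := fun x => by ring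
      have hb₁ := hint b hb f₁ f₁.continuous f₁.hasCompactSupport hs₁'
      have hb₂ := hint b hb f₂ f₂.continuous f₂.hasCompactSupport hs₂'
      simp only [e] at hcorr
      rw [integral_sub_mul_add_mul hgb hb₁ hb₂] at hcorr
      have e' : ∀ x, g x • (b x - (c₁ + c₂ * σ x))
          = b x * g x - (c₁ * g x + c₂ * (σ x * g x)) := fun x => by
        simp only [smul_eq_mul]; ring
      simp only [e']
      rw [integral_sub_mul_add_mul hgb hgi hgσ]
      have : p * B₁ + q * B₂ = c₁ * A + c₂ * S := by
        simp only [hp, hq, c₁, c₂]; field_simp; ring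
      change _ - (p * B₁ + q * B₂) = 0 at hcorr
      rw [this] at hcorr
      exact hcorr
    · refine (tsupport_sub _ _).trans (union_subset hgs ((tsupport_add _ _).trans
        (union_subset ?_ ?_)))
      · exact (tsupport_mul_subset_right).trans hs₁'
      · exact (tsupport_mul_subset_right).trans hs₂'
    · rw [integral_sub_mul_add_mul hgi f₁.integrable f₂.integrable]
      change A - (p * A₁ + q * A₂) = 0
      simp only [hp, hq]
      have := hD.ne
      field_simp
      simp only [D]; ring
    · have e : ∀ x, σ x * (g x - (p * f₁ x + q * f₂ x))
          = σ x * g x - (p * (σ x * f₁ x) + q * (σ x * f₂ x)) := fun x => by ring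
      simp only [e]
      rw [integral_sub_mul_add_mul hgσ hi₁ hi₂]
      change S - (p * S₁ + q * S₂) = 0
      simp only [hp, hq]
      have := hD.ne
      field_simp
      simp only [D]; ring

/-- Integration in polar coordinates. -/
lemma integral_eq_integral_Ioi_toSphere {E : Type*} [NormedAddCommGroup E] [NormedSpace ℝ E]
    [MeasurableSpace E] [Nontrivial E] [FiniteDimensional ℝ E] [BorelSpace E] (μ : Measure E)
    [μ.IsAddHaarMeasure] {f : E → ℝ} (hf : Integrable f μ) :
    ∫ x, f x ∂μ = ∫ r in Ioi (0 : ℝ), r ^ (Module.finrank ℝ E - 1) *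
      ∫ θ : sphere (0 : E) 1, f (r • (θ : E)) ∂μ.toSphere := by
  set F : sphere (0 : E) 1 × Ioi (0 : ℝ) → ℝ := fun p => f ((p.2 : ℝ) • (p.1 : E))
  have hF : ∀ x : ({0}ᶜ : Set E), F (homeomorphUnitSphereProd E x) = f x := by
    intro x
    have hx : ‖(x : E)‖ ≠ 0 := norm_ne_zero_iff.2 x.2
    simp [F, smul_smul, hx]
  have hmp := μ.measurePreserving_homeomorphUnitSphereProd
  have hint : Integrable F (μ.toSphere.prod (.volumeIoiPow (Module.finrank ℝ E - 1))) := by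
    rw [← hmp.integrable_comp_emb (Homeomorph.measurableEmbedding _)]
    have : F ∘ homeomorphUnitSphereProd E = f ∘ ((↑) : ({0}ᶜ : Set E) → E) := funext hF
    rw [this, ← integrableOn_iff_comap_subtypeVal (measurableSet_singleton _).compl]
    exact hf.integrableOn
  calc
    ∫ x, f x ∂μ = ∫ x : ({(0)}ᶜ : Set E), f x.1 ∂(μ.comap (↑)) := by
      rw [integral_subtype_comap (measurableSet_singleton _).compl f, restrict_compl_singleton]
    _ = ∫ p, F p ∂μ.toSphere.prod (.volumeIoiPow (Module.finrank ℝ E - 1)) := by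
      rw [← hmp.integral_comp (Homeomorph.measurableEmbedding _) F]
      simp only [hF]
    _ = ∫ r : Ioi (0 : ℝ), ∫ θ : sphere (0 : E) 1, f ((r : ℝ) • (θ : E)) ∂μ.toSphere
          ∂.volumeIoiPow (Module.finrank ℝ E - 1) := integral_prod_symm F hint
    _ = _ := by
      simp only [Measure.volumeIoiPow, ENNReal.ofReal]
      rw [integral_withDensity_eq_integral_smul,
        integral_subtype_comap measurableSet_Ioi fun a ↦
          Real.toNNReal (a ^ (Module.finrank ℝ E - 1)) •
            ∫ θ : sphere (0 : E) 1, f (a • (θ : E)) ∂μ.toSphere,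
        setIntegral_congr_fun measurableSet_Ioi fun x hx ↦ ?_]
      · rw [NNReal.smul_def, Real.coe_toNNReal _ (pow_nonneg hx.out.le _), smul_eq_mul]
      · exact (measurable_subtype_coe.pow_const _).real_toNNReal

/-- The integral of a directional derivative of a compactly supported `C¹` function vanishes. -/
lemma integral_fderiv_apply_eq_zero {E : Type*} [NormedAddCommGroup E] [NormedSpace ℝ E]
    [MeasurableSpace E] [FiniteDimensional ℝ E] [BorelSpace E] (μ : Measure E)
    [μ.IsAddHaarMeasure] {F : E → ℝ} (hF : ContDiff ℝ 1 F) (hc : HasCompactSupport F) (e : E) :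
    Integrable (fun x => fderiv ℝ F x e) μ ∧ ∫ x, fderiv ℝ F x e ∂μ = 0 := by
  have hi : Integrable (fun x => fderiv ℝ F x e) μ :=
    ((hF.continuous_fderiv one_ne_zero).clm_apply continuous_const).integrable_of_hasCompactSupport
      (hc.fderiv_apply ℝ e)
  refine ⟨hi, ?_⟩
  have := integral_mul_fderiv_eq_neg_fderiv_mul_of_integrable (μ := μ) (f := fun _ => (1 : ℝ))
    (g := F) (v := e) (by simp) (by simpa using hi)
    (by simpa using hF.continuous.integrable_of_hasCompactSupport hc) (by simp)
    (fun x _ => (hF.differentiable one_ne_zero) x)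
  simpa using this

/-- Green's second identity for a function harmonic on an open set, against a test function. -/
lemma integral_mul_laplacian_eq_zero {n : ℕ} {U : Set (EuclideanSpace ℝ (Fin n))} (hU : IsOpen U)
    {v φ : EuclideanSpace ℝ (Fin n) → ℝ} (hv : ContDiffOn ℝ 2 v U)
    (hharm : ∀ x ∈ U, ∑ i : Fin n,
      fderiv ℝ (fun y => fderiv ℝ v y (EuclideanSpace.single i (1 : ℝ))) x
        (EuclideanSpace.single i (1 : ℝ)) = 0)
    (hφ : ContDiff ℝ 2 φ) (hφc : HasCompactSupport φ) (hφU : tsupport φ ⊆ U) :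
    ∫ x, v x * ∑ i : Fin n,
      fderiv ℝ (fun y => fderiv ℝ φ y (EuclideanSpace.single i (1 : ℝ))) x
        (EuclideanSpace.single i (1 : ℝ)) = 0 := by
  set e : Fin n → EuclideanSpace ℝ (Fin n) := fun i => EuclideanSpace.single i (1 : ℝ)
  set F : Fin n → EuclideanSpace ℝ (Fin n) → ℝ := fun i x =>
    v x * fderiv ℝ φ x (e i) - φ x * fderiv ℝ v x (e i) with hFdef
  have hφ0 : ∀ x ∉ U, φ =ᶠ[𝓝 x] 0 := fun x hx =>
    notMem_tsupport_iff_eventuallyEq.1 fun h => hx (hφU h)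
  have hF0 : ∀ i, ∀ x ∉ tsupport φ, F i =ᶠ[𝓝 x] 0 := by
    intro i x hx
    have h0 := notMem_tsupport_iff_eventuallyEq.1 hx
    filter_upwards [h0.eventuallyEq_nhds] with y hy
    have h1 : fderiv ℝ φ y = 0 := by rw [hy.fderiv_eq]; simp
    simp [hFdef, h1, hy.eq_of_nhds]
  have hφ1 : ∀ i, ContDiff ℝ 1 fun y => fderiv ℝ φ y (e i) := fun i =>
    (hφ.fderiv_right (m := 1) (by norm_num)).clm_apply contDiff_const
  have hv1 : ∀ i, ∀ x ∈ U, ContDiffAt ℝ 1 (fun y => fderiv ℝ v y (e i)) x := fun i x hx =>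
    ((hv.contDiffAt (hU.mem_nhds hx)).fderiv_right (m := 1) (by norm_num)).clm_apply
      contDiffAt_const
  have hFC : ∀ i, ContDiff ℝ 1 (F i) := by
    intro i
    refine contDiff_iff_contDiffAt.2 fun x => ?_
    by_cases hx : x ∈ U
    · exact (((hv.contDiffAt (hU.mem_nhds hx)).of_le (by norm_num)).mul (hφ1 i).contDiffAt).sub
        ((hφ.contDiffAt.of_le (by norm_num)).mul (hv1 i x hx))
    · exact (contDiffAt_const (c := (0 : ℝ))).congr_of_eventuallyEq
        (hF0 i x fun h => hx (hφU h))
  have hFc : ∀ i, HasCompactSupport (F i) := fun i =>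
    HasCompactSupport.intro hφc fun x hx => (hF0 i x hx).eq_of_nhds
  have hsum : ∀ x, v x * ∑ i : Fin n, fderiv ℝ (fun y => fderiv ℝ φ y (e i)) x (e i)
      = ∑ i, fderiv ℝ (F i) x (e i) := by
    intro x
    by_cases hx : x ∈ U
    · have hvd : DifferentiableAt ℝ v x :=
        (hv.contDiffAt (hU.mem_nhds hx)).differentiableAt (by norm_num)
      have hφd : DifferentiableAt ℝ φ x := hφ.contDiffAt.differentiableAt (by norm_num)
      have hterm : ∀ i, fderiv ℝ (F i) x (e i)
          = v x * fderiv ℝ (fun y => fderiv ℝ φ y (e i)) x (e i)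
            - φ x * fderiv ℝ (fun y => fderiv ℝ v y (e i)) x (e i) := by
        intro i
        have hφd1 := (hφ1 i).contDiffAt (x := x) |>.differentiableAt one_ne_zero
        have hvd1 := (hv1 i x hx).differentiableAt one_ne_zero
        have := (hvd.hasFDerivAt.fun_mul hφd1.hasFDerivAt).fun_sub
          (hφd.hasFDerivAt.fun_mul hvd1.hasFDerivAt)
        simp only [hFdef]
        rw [this.fderiv]
        simp
        ring
      simp only [hterm, Finset.sum_sub_distrib, ← Finset.mul_sum]
      rw [hharm x hx]
      simp
    · have hx' : x ∉ tsupport φ := fun h => hx (hφU h)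
      have hl : ∀ i, fderiv ℝ (fun y => fderiv ℝ φ y (e i)) x = 0 := by
        intro i
        have : (fun y => fderiv ℝ φ y (e i)) =ᶠ[𝓝 x] fun _ => 0 := by
          filter_upwards [(hφ0 x hx).eventuallyEq_nhds] with y hy
          rw [hy.fderiv_eq]; simp
        rw [this.fderiv_eq]; simp
      have hr : ∀ i, fderiv ℝ (F i) x = 0 := fun i => by
        rw [(hF0 i x hx').fderiv_eq]; simp
      simp [hl, hr]
  simp only [e] at hsum
  simp only [hsum]
  rw [integral_finsetSum _ fun i _ => (integral_fderiv_apply_eq_zero volume (hFC i) (hFc i) _).1]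
  exact Finset.sum_eq_zero fun i _ => (integral_fderiv_apply_eq_zero volume (hFC i) (hFc i) _).2

/-- Euler's identity for positively homogeneous functions. -/
lemma fderiv_apply_self_of_homogeneous {E : Type*} [NormedAddCommGroup E] [NormedSpace ℝ E]
    {Y : E → ℝ} {k : ℕ} {x : E} (hY : DifferentiableAt ℝ Y x)
    (hhom : ∀ c : ℝ, 0 ≤ c → Y (c • x) = c ^ k * Y x) : fderiv ℝ Y x x = k * Y x := by
  have h1 : HasDerivAt (fun c : ℝ => Y (c • x)) (fderiv ℝ Y x x) 1 := by
    have hc : HasDerivAt (fun c : ℝ => c • x) x 1 := by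
      simpa using (hasDerivAt_id (1 : ℝ)).smul_const x
    have hY' : HasFDerivAt Y (fderiv ℝ Y x) ((1 : ℝ) • x) := by simpa using hY.hasFDerivAt
    exact hY'.comp_hasDerivAt 1 hc
  have h2 : HasDerivAt (fun c : ℝ => c ^ k * Y x) (k * Y x) 1 := by
    simpa using (hasDerivAt_pow k (1 : ℝ)).mul_const (Y x)
  refine h1.unique (h2.congr_of_eventuallyEq ?_)
  filter_upwards [eventually_ge_nhds (zero_lt_one : (0 : ℝ) < 1)] with c hc
  exact hhom c hc

/-- The Laplacian of the product of a radial function and a homogeneous harmonic function. -/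
lemma laplacian_radial_mul_harmonic {n : ℕ} {Y : EuclideanSpace ℝ (Fin n) → ℝ} {k : ℕ}
    (hY : ContDiff ℝ 2 Y)
    (hhom : ∀ (c : ℝ) (x : EuclideanSpace ℝ (Fin n)), 0 ≤ c → Y (c • x) = c ^ k * Y x)
    {x : EuclideanSpace ℝ (Fin n)}
    (hharm : ∑ i : Fin n, fderiv ℝ (fun y => fderiv ℝ Y y (EuclideanSpace.single i (1 : ℝ))) x
      (EuclideanSpace.single i (1 : ℝ)) = 0)
    {ζ ζ₁ ζ₂ : ℝ → ℝ} (h₁ : ∀ s, HasDerivAt ζ (ζ₁ s) s) (h₂ : ∀ s, HasDerivAt ζ₁ (ζ₂ s) s) :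
    ∑ i : Fin n, fderiv ℝ
      (fun y => fderiv ℝ (fun z => ζ (‖z‖ ^ 2) * Y z) y (EuclideanSpace.single i (1 : ℝ))) x
        (EuclideanSpace.single i (1 : ℝ))
      = (4 * ‖x‖ ^ 2 * ζ₂ (‖x‖ ^ 2) + (2 * n + 4 * k) * ζ₁ (‖x‖ ^ 2)) * Y x := by
  set e : Fin n → EuclideanSpace ℝ (Fin n) := fun i => EuclideanSpace.single i (1 : ℝ) with he
  have hYd : Differentiable ℝ Y := hY.differentiable (by norm_num)
  have hsq : ∀ y : EuclideanSpace ℝ (Fin n),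
      HasFDerivAt (fun z : EuclideanSpace ℝ (Fin n) => ‖z‖ ^ 2) (2 • innerSL ℝ y) y :=
    fun y => (hasStrictFDerivAt_norm_sq y).hasFDerivAt
  have hinner : ∀ (y : EuclideanSpace ℝ (Fin n)) i, inner ℝ y (e i) = y i := by
    intro y i; simp [he, EuclideanSpace.inner_single_right]
  have hfirst : ∀ i, (fun y => fderiv ℝ (fun z => ζ (‖z‖ ^ 2) * Y z) y (e i))
      = fun y => ζ (‖y‖ ^ 2) * fderiv ℝ Y y (e i) + Y y * (ζ₁ (‖y‖ ^ 2) * (2 * y i)) := by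
    intro i
    funext y
    have hz : HasFDerivAt (fun z : EuclideanSpace ℝ (Fin n) => ζ (‖z‖ ^ 2)) _ y :=
      (h₁ (‖y‖ ^ 2)).comp_hasFDerivAt y (hsq y)
    rw [(hz.fun_mul (hYd y).hasFDerivAt).fderiv]
    simp [hinner]
  have hterm : ∀ i, fderiv ℝ (fun y => fderiv ℝ (fun z => ζ (‖z‖ ^ 2) * Y z) y (e i)) x (e i)
      = ζ (‖x‖ ^ 2) * fderiv ℝ (fun y => fderiv ℝ Y y (e i)) x (e i)
        + 4 * ζ₁ (‖x‖ ^ 2) * (x i * fderiv ℝ Y x (e i))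
        + 4 * ζ₂ (‖x‖ ^ 2) * Y x * (x i) ^ 2 + 2 * ζ₁ (‖x‖ ^ 2) * Y x := by
    intro i
    rw [hfirst i]
    have hz : HasFDerivAt (fun z : EuclideanSpace ℝ (Fin n) => ζ (‖z‖ ^ 2)) _ x :=
      (h₁ (‖x‖ ^ 2)).comp_hasFDerivAt x (hsq x)
    have hz₁ : HasFDerivAt (fun z : EuclideanSpace ℝ (Fin n) => ζ₁ (‖z‖ ^ 2)) _ x :=
      (h₂ (‖x‖ ^ 2)).comp_hasFDerivAt x (hsq x)
    have hY1 : DifferentiableAt ℝ (fun y => fderiv ℝ Y y (e i)) x :=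
      ((hY.fderiv_right (m := 1) (by norm_num)).clm_apply contDiff_const).differentiable
        one_ne_zero x
    have hx : HasFDerivAt (fun y : EuclideanSpace ℝ (Fin n) => 2 * y i)
        ((2 : ℝ) • (EuclideanSpace.proj i : EuclideanSpace ℝ (Fin n) →L[ℝ] ℝ)) x :=
      (EuclideanSpace.proj i : EuclideanSpace ℝ (Fin n) →L[ℝ] ℝ).hasFDerivAt.const_mul 2
    have hei : e i i = 1 := by simp [he]
    rw [((hz.fun_mul hY1.hasFDerivAt).fun_add ((hYd x).hasFDerivAt.fun_mul (hz₁.fun_mul hx))).fderiv]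
    simp [hinner, hei]
    ring
  have hexp : ∑ i, x i * fderiv ℝ Y x (e i) = k * Y x := by
    have hx : ∑ i, x i • e i = x := by
      simpa [he] using (EuclideanSpace.basisFun (Fin n) ℝ).sum_repr x
    rw [← fderiv_apply_self_of_homogeneous (hYd x) fun c hc => hhom c x hc]
    simpa using congrArg (fderiv ℝ Y x) hx
  have hnorm : ∑ i, (x i) ^ 2 = ‖x‖ ^ 2 := by
    rw [EuclideanSpace.norm_sq_eq]; simp
  change ∑ i, fderiv ℝ (fun y => fderiv ℝ (fun z => ζ (‖z‖ ^ 2) * Y z) y (e i)) x (e i) = _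
  change ∑ i, fderiv ℝ (fun y => fderiv ℝ Y y (e i)) x (e i) = 0 at hharm
  simp only [hterm, Finset.sum_add_distrib, ← Finset.mul_sum]
  rw [hexp, hnorm, hharm]
  simp
  ring

/-- The Leibniz rule for `s ↦ s ^ q * F s`, valid at all points when `F` is supported in `(0, ∞)`. -/
lemma hasDerivAt_rpow_mul_of_tsupport_subset {F g : ℝ → ℝ} (hF : ∀ s, HasDerivAt F (g s) s)
    (hFs : tsupport F ⊆ Ioi 0) (q s : ℝ) :
    HasDerivAt (fun s => s ^ q * F s) (q * (s ^ (q - 1) * F s) + s ^ q * g s) s := by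
  by_cases hs : s ∈ Ioi (0 : ℝ)
  · have := (hasDerivAt_rpow_const (p := q) (Or.inl (ne_of_gt hs))).mul (hF s)
    exact this.congr_deriv (by ring)
  · have h0 : F =ᶠ[𝓝 s] 0 := notMem_tsupport_iff_eventuallyEq.1 fun h => hs (hFs h)
    have hg : g s = 0 := (hF s).unique ((hasDerivAt_const s (0 : ℝ)).congr_of_eventuallyEq h0)
    have h1 : (fun s => s ^ q * F s) =ᶠ[𝓝 s] fun _ => 0 := by
      filter_upwards [h0] with t ht
      simp [ht]
    refine ((hasDerivAt_const s (0 : ℝ)).congr_of_eventuallyEq h1).congr_deriv ?_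
    simp [h0.eq_of_nhds, hg]

lemma continuousOn_rpow_Ioi (q : ℝ) : ContinuousOn (fun s : ℝ => s ^ q) (Ioi 0) :=
  fun s hs => (continuousAt_rpow_const s q (Or.inl (ne_of_gt hs))).continuousWithinAt

/-- The equation `s ζ'' + p ζ' = s ^ (1 - p) g` has a compactly supported solution as soon as `g` is
annihilated by `1` and by `s ^ (1 - p)`. -/
lemma exists_compactSupport_solution {p : ℝ} (hp : 1 < p) {g : ℝ → ℝ} (hg : Continuous g)
    (hgc : HasCompactSupport g) (hgs : tsupport g ⊆ Ioi 1) (h0 : ∫ x, g x = 0)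
    (h1 : ∫ x, x ^ (1 - p) * g x = 0) :
    ∃ (ζ ζ₁ ζ₂ : ℝ → ℝ) (α β : ℝ), 1 < α ∧ (∀ s, HasDerivAt ζ (ζ₁ s) s) ∧
      (∀ s, HasDerivAt ζ₁ (ζ₂ s) s) ∧ Continuous ζ₂ ∧ (∀ s ∉ Icc α β, ζ s = 0) ∧
      ∀ s, s * ζ₂ s + p * ζ₁ s = s ^ (1 - p) * g s := by
  obtain ⟨α, β, hα, hαβ⟩ := IsCompact.exists_subset_Icc_of_subset_Ioi hgc hgs
  have hg0 : ∀ s ∉ Icc α β, g s = 0 := fun s hs =>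
    image_eq_zero_of_notMem_tsupport fun h => hs (hαβ h)
  obtain ⟨F, hF, hF0⟩ := exists_antideriv_of_integral_eq_zero hg hg0 h0
  have hFc : Continuous F := continuous_iff_continuousAt.2 fun s => (hF s).continuousAt
  have hFcs : HasCompactSupport F := HasCompactSupport.intro isCompact_Icc hF0
  have hI : Icc α β ⊆ Ioi 0 := fun s hs => mem_Ioi.2 (by linarith [hs.1])
  have hFs : tsupport F ⊆ Ioi 0 := (closure_minimal (fun s hs => by
    by_contra hc
    exact hs (hF0 s hc)) isClosed_Icc).trans hI
  have hd := hasDerivAt_rpow_mul_of_tsupport_subset hF hFs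
  have hcF : ∀ q : ℝ, Continuous fun s => s ^ q * F s := fun q =>
    (continuousOn_rpow_Ioi q).continuous_mul_of_tsupport_subset isOpen_Ioi hFc hFs
  have hcg : ∀ q : ℝ, Continuous fun s => s ^ q * g s := fun q =>
    (continuousOn_rpow_Ioi q).continuous_mul_of_tsupport_subset isOpen_Ioi hg (hαβ.trans hI)
  have hiF : ∀ q : ℝ, Integrable fun s => s ^ q * F s := fun q =>
    (hcF q).integrable_of_hasCompactSupport hFcs.mul_left
  have hig : ∀ q : ℝ, Integrable fun s => s ^ q * g s := fun q =>
    (hcg q).integrable_of_hasCompactSupport hgc.mul_left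
  have hint : ∫ s, s ^ (-p) * F s = 0 := by
    have hz := integral_eq_zero_of_hasDerivAt_of_integrable (hd (1 - p))
      (((hiF _).const_mul _).add (hig _)) (hiF _)
    rw [integral_add ((hiF _).const_mul _) (hig _), h1, integral_const_mul, add_zero] at hz
    rcases mul_eq_zero.1 hz with h | h
    · linarith
    · rwa [show 1 - p - 1 = -p by ring] at h
  obtain ⟨ζ, hζ, hζ0⟩ := exists_antideriv_of_integral_eq_zero (hcF (-p)) (α := α) (β := β)
    (fun s hs => by simp [hF0 s hs]) hint
  refine ⟨ζ, _, _, α, β, hα, hζ, hd (-p), ((hcF _).const_mul _).add (hcg _), hζ0, fun s => ?_⟩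
  by_cases hI' : s ∈ Icc α β
  swap
  · simp [hF0 s hI', hg0 s hI']
  have hs : 0 < s := hI hI'
  have e1 : s ^ (-p) = s * s ^ (-p - 1) := by
    rw [rpow_sub_one hs.ne']; field_simp
  have e2 : s ^ (1 - p) = s * s ^ (-p) := by
    rw [show 1 - p = -p + 1 by ring, rpow_add_one hs.ne']; ring
  rw [e2]
  linear_combination p * F s * e1

lemma contDiff_two_of_hasDerivAt {ζ ζ₁ ζ₂ : ℝ → ℝ} (h₁ : ∀ s, HasDerivAt ζ (ζ₁ s) s)
    (h₂ : ∀ s, HasDerivAt ζ₁ (ζ₂ s) s) (hc : Continuous ζ₂) : ContDiff ℝ 2 ζ := by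
  have e₁ : deriv ζ = ζ₁ := funext fun s => (h₁ s).deriv
  have e₂ : deriv ζ₁ = ζ₂ := funext fun s => (h₂ s).deriv
  have hζ₁ : ContDiff ℝ 1 ζ₁ :=
    contDiff_one_iff_deriv.2 ⟨fun s => (h₂ s).differentiableAt, e₂ ▸ hc⟩
  rw [show (2 : WithTop ℕ∞) = 1 + 1 by norm_num, contDiff_succ_iff_deriv]
  exact ⟨fun s => (h₁ s).differentiableAt, by simp, e₁ ▸ hζ₁⟩

/-- The weak form of the radial equation satisfied by the coefficient of a harmonic function along a
homogeneous harmonic function of degree `k`. -/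
lemma integral_coeff_mul_eq_zero {n : ℕ} (hn : 3 ≤ n) {v : EuclideanSpace ℝ (Fin n) → ℝ}
    (hv : ContDiffOn ℝ 2 v {x : EuclideanSpace ℝ (Fin n) | 1 < ‖x‖})
    (hharm : ∀ x : EuclideanSpace ℝ (Fin n), 1 < ‖x‖ →
      ∑ i : Fin n,
        fderiv ℝ (fun y => fderiv ℝ v y (EuclideanSpace.single i (1 : ℝ))) x
          (EuclideanSpace.single i (1 : ℝ)) = 0)
    {k : ℕ} {Y : EuclideanSpace ℝ (Fin n) → ℝ} (hY : ContDiff ℝ 2 Y)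
    (hYhom : ∀ (c : ℝ) (x : EuclideanSpace ℝ (Fin n)), 0 ≤ c → Y (c • x) = c ^ k * Y x)
    (hYharm : ∀ x : EuclideanSpace ℝ (Fin n),
      ∑ i : Fin n,
        fderiv ℝ (fun y => fderiv ℝ Y y (EuclideanSpace.single i (1 : ℝ))) x
          (EuclideanSpace.single i (1 : ℝ)) = 0)
    {g : ℝ → ℝ} (hg : Continuous g)
    (hgc : HasCompactSupport g) (hgs : tsupport g ⊆ Ioi 1) (h0 : ∫ x, g x = 0)
    (h1 : ∫ x, x ^ (1 - ((n : ℝ) / 2 + k)) * g x = 0) :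
    ∫ s, (√s ^ (-(k : ℝ)) * ∫ θ : sphere (0 : EuclideanSpace ℝ (Fin n)) 1,
      v (√s • (θ : EuclideanSpace ℝ (Fin n))) * Y θ ∂(volume.toSphere)) * g s = 0 := by
  have hn' : (3 : ℝ) ≤ n := by exact_mod_cast hn
  have : Nontrivial (EuclideanSpace ℝ (Fin n)) := by
    have : Nonempty (Fin n) := ⟨⟨0, by omega⟩⟩
    infer_instance
  set p : ℝ := (n : ℝ) / 2 + k with hp
  have hp1 : 1 < p := by
    have : (0 : ℝ) ≤ k := k.cast_nonneg
    linarith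
  obtain ⟨ζ, ζ₁, ζ₂, α, β, hα, h₁, h₂, hc₂, hζ0, heq⟩ :=
    exists_compactSupport_solution hp1 hg hgc hgs h0 h1
  set U := {x : EuclideanSpace ℝ (Fin n) | 1 < ‖x‖}
  have hU : IsOpen U := isOpen_lt continuous_const continuous_norm
  set φ : EuclideanSpace ℝ (Fin n) → ℝ := fun x => ζ (‖x‖ ^ 2) * Y x with hφdef
  have hφ : ContDiff ℝ 2 φ :=
    ((contDiff_two_of_hasDerivAt h₁ h₂ hc₂).comp (contDiff_norm_sq ℝ)).mul hY
  have key : ∀ A B : ℝ, 1 < A → IsCompact {x : EuclideanSpace ℝ (Fin n) | ‖x‖ ^ 2 ∈ Icc A B} ∧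
      {x : EuclideanSpace ℝ (Fin n) | ‖x‖ ^ 2 ∈ Icc A B} ⊆ U := by
    intro A B hA
    constructor
    · refine (isCompact_closedBall (0 : EuclideanSpace ℝ (Fin n)) √B).of_isClosed_subset
        (isClosed_Icc.preimage (by fun_prop)) fun x hx => ?_
      rw [mem_closedBall_zero_iff]
      exact Real.le_sqrt_of_sq_le hx.2
    · intro x hx
      have : 1 < ‖x‖ ^ 2 := hA.trans_le hx.1
      exact (one_lt_sq_iff₀ (norm_nonneg x)).1 this
  obtain ⟨hK, hKU⟩ := key α β hα
  have hφ0 : ∀ x ∉ {x : EuclideanSpace ℝ (Fin n) | ‖x‖ ^ 2 ∈ Icc α β}, φ x = 0 := fun x hx => by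
    simp only [hφdef, hζ0 _ hx, zero_mul]
  have hφs : tsupport φ ⊆ U := (closure_minimal (fun x hx => by
    by_contra hc
    exact hx (hφ0 x hc)) hK.isClosed).trans hKU
  have hgreen := integral_mul_laplacian_eq_zero hU hv hharm hφ (HasCompactSupport.intro hK hφ0) hφs
  -- the test function appearing after taking the Laplacian
  set H : ℝ → ℝ := fun s => 4 * s * ζ₂ s + (2 * n + 4 * k) * ζ₁ s with hHdef
  have hH : ∀ s, H s = 4 * (s ^ (1 - p) * g s) := fun s => by
    rw [← heq s, hHdef, hp]; ring
  have hHc : Continuous H := by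
    have : Continuous ζ₁ := continuous_iff_continuousAt.2 fun s => (h₂ s).continuousAt
    fun_prop
  obtain ⟨α', β', hα', hg'⟩ := IsCompact.exists_subset_Icc_of_subset_Ioi hgc hgs
  obtain ⟨hK', hKU'⟩ := key α' β' hα'
  set f : EuclideanSpace ℝ (Fin n) → ℝ := fun x => H (‖x‖ ^ 2) * Y x with hfdef
  have hlap : ∀ x, v x * ∑ i : Fin n, fderiv ℝ
      (fun y => fderiv ℝ φ y (EuclideanSpace.single i (1 : ℝ))) x
        (EuclideanSpace.single i (1 : ℝ)) = v x * f x := fun x => by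
    rw [laplacian_radial_mul_harmonic hY hYhom (hYharm x) h₁ h₂]
  simp only [hlap] at hgreen
  have hf0 : ∀ x ∉ {x : EuclideanSpace ℝ (Fin n) | ‖x‖ ^ 2 ∈ Icc α' β'}, f x = 0 := by
    intro x hx
    have : g (‖x‖ ^ 2) = 0 := image_eq_zero_of_notMem_tsupport fun h => hx (hg' h)
    simp [hfdef, hH, this]
  have hfs : tsupport f ⊆ U := (closure_minimal (fun x hx => by
    by_contra hc
    exact hx (hf0 x hc)) hK'.isClosed).trans hKU'
  have hfc : Continuous f := by
    have := hY.continuous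
    fun_prop
  have hint : Integrable fun x => v x * f x :=
    (hv.continuousOn.continuous_mul_of_tsupport_subset hU hfc hfs).integrable_of_hasCompactSupport
      (HasCompactSupport.intro hK' hf0).mul_left
  rw [integral_eq_integral_Ioi_toSphere volume hint, finrank_euclideanSpace_fin] at hgreen
  set a : ℝ → ℝ := fun r => ∫ θ : sphere (0 : EuclideanSpace ℝ (Fin n)) 1,
    v (r • (θ : EuclideanSpace ℝ (Fin n))) * Y θ ∂(volume.toSphere)
  set G : ℝ → ℝ := fun s => (√s ^ (-(k : ℝ)) * a √s) * g s with hGdef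
  have hstep : ∀ r ∈ Ioi (0 : ℝ), r ^ (n - 1) * ∫ θ : sphere (0 : EuclideanSpace ℝ (Fin n)) 1,
      v (r • (θ : EuclideanSpace ℝ (Fin n))) * f (r • (θ : EuclideanSpace ℝ (Fin n)))
        ∂(volume.toSphere) = 2 * (((2 : ℝ) * r ^ ((2 : ℝ) - 1)) • G (r ^ (2 : ℝ))) := by
    intro r hr
    have hr : 0 < r := hr
    have hin : ∀ θ : sphere (0 : EuclideanSpace ℝ (Fin n)) 1,
        v (r • (θ : EuclideanSpace ℝ (Fin n))) * f (r • (θ : EuclideanSpace ℝ (Fin n)))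
          = H (r ^ 2) * r ^ k * (v (r • (θ : EuclideanSpace ℝ (Fin n))) * Y θ) := by
      intro θ
      have : ‖r • (θ : EuclideanSpace ℝ (Fin n))‖ = r := by
        rw [norm_smul, norm_eq_of_mem_sphere, mul_one, Real.norm_of_nonneg hr.le]
      simp only [hfdef, this, hYhom r _ hr.le]
      ring
    simp only [hin]
    rw [integral_const_mul, hH]
    have e2 : (r ^ 2) ^ (1 - p) = r ^ (2 * (1 - p)) := by
      rw [← rpow_natCast, ← rpow_mul hr.le]; norm_num
    have e3 : r ^ (n - 1) * r ^ (2 * (1 - p)) * r ^ k = r * r ^ (-(k : ℝ)) := by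
      rw [← rpow_natCast, ← rpow_natCast, ← rpow_add hr, ← rpow_add hr, 
        show r * r ^ (-(k : ℝ)) = r ^ (1 + -(k : ℝ)) by rw [rpow_add hr, rpow_one],
        Nat.cast_sub (by omega)]
      congr 1
      rw [hp]; push_cast; ring
    have e4 : √(r ^ 2) = r := Real.sqrt_sq hr.le
    rw [show (2 : ℝ) - 1 = 1 by norm_num, rpow_one, rpow_two, hGdef]
    simp only [e4, smul_eq_mul, e2]
    change r ^ (n - 1) * (4 * (r ^ (2 * (1 - p)) * g (r ^ 2)) * r ^ k * a r) = _
    linear_combination (4 * g (r ^ 2) * a r) * e3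
  rw [setIntegral_congr_fun measurableSet_Ioi hstep, integral_const_mul,
    integral_comp_rpow_Ioi_of_pos two_pos] at hgreen
  have hG : ∫ s in Ioi (0 : ℝ), G s = 0 := by linarith
  rw [setIntegral_eq_integral_of_forall_compl_eq_zero] at hG
  · exact hG
  · intro s hs
    have : g s = 0 := image_eq_zero_of_notMem_tsupport fun h =>
      hs (mem_Ioi.2 (zero_lt_one.trans (hgs h)))
    simp [hGdef, this]

lemma tendsto_rpow_mul_zero_of_abs_le {a : ℝ → ℝ} {M q κ e : ℝ}
    (ha : ∀ r, 1 < r → |a r| ≤ M * (r ^ q * Real.log r ^ κ)) (he : e + q < 0) :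
    Tendsto (fun r => r ^ e * a r) atTop (𝓝 0) := by
  have hlim : Tendsto (fun r : ℝ => M * (Real.log r ^ κ / r ^ (-(e + q)))) atTop (𝓝 0) := by
    simpa using (isLittleO_log_rpow_rpow_atTop κ (neg_pos.2 he)).tendsto_div_nhds_zero.const_mul M
  refine squeeze_zero_norm' ?_ hlim
  filter_upwards [eventually_gt_atTop 1] with r hr
  have hr0 : 0 < r := zero_lt_one.trans hr
  rw [norm_mul, Real.norm_eq_abs, Real.norm_eq_abs, abs_of_pos (rpow_pos_of_pos hr0 e)]
  refine (mul_le_mul_of_nonneg_left (ha r hr) (rpow_pos_of_pos hr0 e).le).trans_eq ?_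
  rw [rpow_neg hr0.le, rpow_add hr0, div_inv_eq_mul]
  ring

/-- let `v` be harmonic on the exterior domain `{‖x‖ > 1} ⊂ ℝⁿ`
with `|v(x)| ≤ C ‖x‖^(2-k₃) (log ‖x‖)^k₄`, `k₃ ≥ n`.  For any (restriction to
the sphere of a) degree-`k` spherical harmonic `Y` (i.e. a harmonic function
homogeneous of degree `k`), the expansion coefficient
`a(r) = ∫_{𝕊^{n-1}} v(rθ) Y(θ) dθ` is of the form `C₂ r^(2-n-k)`; moreover
`C₂ = 0` whenever `k < k₃ - n`. -/
theorem harmonic_expansion_coefficients (n : ℕ) (hn : 3 ≤ n)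
    (v : EuclideanSpace ℝ (Fin n) → ℝ)
    (hv : ContDiffOn ℝ 2 v {x : EuclideanSpace ℝ (Fin n) | 1 < ‖x‖})
    (hharm : ∀ x : EuclideanSpace ℝ (Fin n), 1 < ‖x‖ →
      ∑ i : Fin n,
        fderiv ℝ (fun y => fderiv ℝ v y (EuclideanSpace.single i (1 : ℝ))) x
          (EuclideanSpace.single i (1 : ℝ)) = 0)
    (C k₃ k₄ : ℝ) (hC : 0 ≤ C) (hk₃ : (n : ℝ) ≤ k₃) (hk₄ : 0 ≤ k₄)
    (hbd : ∀ x : EuclideanSpace ℝ (Fin n), 1 < ‖x‖ →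
      |v x| ≤ C * ‖x‖ ^ (2 - k₃) * (Real.log ‖x‖) ^ k₄)
    (k : ℕ) (Y : EuclideanSpace ℝ (Fin n) → ℝ)
    (hYsmooth : ContDiff ℝ 2 Y)
    (hYhom : ∀ (c : ℝ) (x : EuclideanSpace ℝ (Fin n)), 0 ≤ c → Y (c • x) = c ^ k * Y x)
    (hYharm : ∀ x : EuclideanSpace ℝ (Fin n),
      ∑ i : Fin n,
        fderiv ℝ (fun y => fderiv ℝ Y y (EuclideanSpace.single i (1 : ℝ))) x
          (EuclideanSpace.single i (1 : ℝ)) = 0)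
    (a : ℝ → ℝ)
    (ha : a = fun r : ℝ =>
      ∫ θ : sphere (0 : EuclideanSpace ℝ (Fin n)) 1,
        v (r • (θ : EuclideanSpace ℝ (Fin n))) * Y (θ : EuclideanSpace ℝ (Fin n))
          ∂(volume.toSphere)) :
    ∃ C₂ : ℝ, (∀ r : ℝ, 1 < r → a r = C₂ * r ^ ((2 : ℤ) - n - k)) ∧
      ((k : ℝ) < k₃ - n → C₂ = 0) := by
  have hn' : (3 : ℝ) ≤ n := by exact_mod_cast hn
  have hk' : (0 : ℝ) ≤ k := k.cast_nonneg
  have hYc := hYsmooth.continuous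
  have hnorm : ∀ (r : ℝ), 1 < r → ∀ θ : sphere (0 : EuclideanSpace ℝ (Fin n)) 1,
      ‖r • (θ : EuclideanSpace ℝ (Fin n))‖ = r := fun r hr θ => by
    rw [norm_smul, norm_eq_of_mem_sphere, mul_one, Real.norm_of_nonneg (by linarith)]
  have hac : ContinuousOn a (Ioi 1) := by
    rw [continuousOn_iff_continuous_domRestrict]
    have : LocallyCompactSpace (Ioi (1 : ℝ)) := isOpen_Ioi.locallyCompactSpace
    have huncurry : Continuous (Function.uncurry fun (r : Ioi (1 : ℝ))
        (θ : sphere (0 : EuclideanSpace ℝ (Fin n)) 1) =>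
          v ((r : ℝ) • (θ : EuclideanSpace ℝ (Fin n))) * Y θ) := by
      refine Continuous.mul ?_ (by fun_prop)
      refine hv.continuousOn.comp_continuous (by fun_prop) fun p => ?_
      change 1 < ‖_‖
      rw [hnorm _ p.1.2 p.2]
      exact p.1.2
    have := continuous_parametric_integral_of_continuous (μ := volume.toSphere) huncurry
      (isCompact_univ (X := sphere (0 : EuclideanSpace ℝ (Fin n)) 1))
    rw [ha]
    simpa only [Measure.restrict_univ] using! this
  have hab : ∀ r, 1 < r → |a r| ≤ (C * ∫ θ : sphere (0 : EuclideanSpace ℝ (Fin n)) 1,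
      |Y θ| ∂(volume.toSphere)) * (r ^ (2 - k₃) * Real.log r ^ k₄) := by
    intro r hr
    have hYi : Integrable (fun θ : sphere (0 : EuclideanSpace ℝ (Fin n)) 1 => |Y θ|)
        volume.toSphere :=
      (show Continuous fun θ : sphere (0 : EuclideanSpace ℝ (Fin n)) 1 => |Y θ| by
        fun_prop).integrable_of_hasCompactSupport (HasCompactSupport.of_compactSpace _)
    have := norm_integral_le_of_norm_le (μ := volume.toSphere)
      (f := fun θ : sphere (0 : EuclideanSpace ℝ (Fin n)) 1 =>
        v (r • (θ : EuclideanSpace ℝ (Fin n))) * Y θ)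
      (hYi.const_mul (C * r ^ (2 - k₃) * Real.log r ^ k₄)) (ae_of_all _ fun θ => by
        rw [norm_mul]
        refine mul_le_mul_of_nonneg_right ?_ (abs_nonneg _)
        simpa only [hnorm r hr θ, Real.norm_eq_abs] using hbd (r • (θ : EuclideanSpace ℝ (Fin n)))
          (by rw [hnorm r hr θ]; exact hr))
    rw [integral_const_mul] at this
    rw [ha]
    exact this.trans_eq (by ring)
  set p : ℝ := (n : ℝ) / 2 + k with hp
  have hsqrt : MapsTo Real.sqrt (Ioi 1) (Ioi 1) := fun s hs =>
    Real.lt_sqrt_of_sq_lt (by simpa using hs)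
  have hbc : ContinuousOn (fun s => √s ^ (-(k : ℝ)) * a √s) (Ioi 1) :=
    (((continuousOn_rpow_Ioi _).mono (Ioi_subset_Ioi zero_le_one)).comp
      Real.continuous_sqrt.continuousOn hsqrt).mul
        (hac.comp Real.continuous_sqrt.continuousOn hsqrt)
  obtain ⟨c₁, c₂, hc⟩ := exists_eq_add_mul_of_integral_eq_zero (σ := fun s => s ^ (1 - p)) hbc
    ((continuousOn_rpow_Ioi _).mono (Ioi_subset_Ioi zero_le_one))
    (fun s hs t _ hst => rpow_lt_rpow_of_neg (zero_lt_one.trans hs) hst (by linarith))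
    (fun g hg hgc hgs h0 h1 => by
      rw [ha]
      exact integral_coeff_mul_eq_zero hn hv hharm hYsmooth hYhom hYharm hg hgc hgs h0 h1)
  have hrep : ∀ r, 1 < r → r ^ (-(k : ℝ)) * a r = c₁ + c₂ * r ^ (2 - n - 2 * k : ℝ) := by
    intro r hr
    have hr0 : 0 < r := zero_lt_one.trans hr
    have h := hc (r ^ 2) (one_lt_pow₀ hr two_ne_zero)
    have e2 : (r ^ 2) ^ (1 - p) = r ^ (2 - n - 2 * k : ℝ) := by
      rw [← rpow_natCast, ← rpow_mul hr0.le]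
      congr 1
      rw [hp]; push_cast; ring
    simpa only [Real.sqrt_sq hr0.le, e2] using h
  have hc₁ : c₁ = 0 := by
    have hl : Tendsto (fun r : ℝ => c₁ + c₂ * r ^ (2 - n - 2 * k : ℝ)) atTop (𝓝 c₁) := by
      have := tendsto_rpow_neg_atTop (y := n + 2 * k - 2) (by linarith)
      simp only [show -((n : ℝ) + 2 * k - 2) = 2 - n - 2 * k by ring] at this
      simpa using (this.const_mul c₂).const_add c₁
    refine tendsto_nhds_unique hl
      ((tendsto_rpow_mul_zero_of_abs_le (e := -(k : ℝ)) hab (by linarith)).congr' ?_)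
    filter_upwards [eventually_gt_atTop 1] with r hr using hrep r hr
  have hrep' : ∀ r, 1 < r → a r = c₂ * r ^ (2 - n - k : ℝ) := by
    intro r hr
    have hr0 : 0 < r := zero_lt_one.trans hr
    have h := hrep r hr
    rw [hc₁, zero_add, rpow_neg hr0.le, inv_mul_eq_iff_eq_mul₀ (rpow_pos_of_pos hr0 _).ne'] at h
    rw [h, mul_left_comm, ← rpow_add hr0]
    congr 2
    ring
  refine ⟨c₂, fun r hr => ?_, fun hk => ?_⟩
  · rw [hrep' r hr, ← rpow_intCast]
    push_cast
    rfl
  · refine tendsto_nhds_unique (tendsto_const_nhds (x := c₂) (f := atTop (α := ℝ)))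
      ((tendsto_rpow_mul_zero_of_abs_le (e := n + k - 2) hab (by linarith)).congr' ?_)
    filter_upwards [eventually_gt_atTop 1] with r hr
    have hr0 : 0 < r := zero_lt_one.trans hr
    rw [hrep' r hr, mul_left_comm, ← rpow_add hr0,
      show (n : ℝ) + k - 2 + (2 - n - k) = 0 by ring, rpow_zero, mul_one]
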